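/- arXiv:1811.01600 — 2 statements merged into one kernel-verified Lean document; each statement's English description precedes it below -/
import Mathlib

section
/- If f ∈ ℝ[z_1,…,z_n] is completely log-concave and T : ℝ^m → ℝ^n is an affine transformation with T(ℝ_{≥0}^m) ⊆ ℝ_{≥0}^n, then the polynomial f(T(y_1,…,y_m)) ∈ ℝ[y_1,…,y_m] is completely log-concave. -/
open Matrix MvPolynomial

/-- The directional derivative operator `D_v = ∑ i, v i • ∂_i`. -/
noncomputable def dirDeriv {m : ℕ} (v : Fin m → ℝ) (f : MvPolynomial (Fin m) ℝ) :
    MvPolynomial (Fin m) ℝ :=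
  ∑ i, MvPolynomial.C (v i) * MvPolynomial.pderiv i f

/-- `f` is nonnegative and log-concave as a function on the nonnegative orthant. -/
def LogConcaveOn {m : ℕ} (f : MvPolynomial (Fin m) ℝ) : Prop :=
  (∀ x : Fin m → ℝ, (∀ i, 0 ≤ x i) → 0 ≤ MvPolynomial.eval x f) ∧
  ∀ u v : Fin m → ℝ, (∀ i, 0 ≤ u i) → (∀ i, 0 ≤ v i) →
    ∀ t : ℝ, 0 ≤ t → t ≤ 1 →
      (MvPolynomial.eval u f) ^ t * (MvPolynomial.eval v f) ^ (1 - t) ≤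
        MvPolynomial.eval (fun i => t * u i + (1 - t) * v i) f

/-- `f` is completely log-concave: every iterated directional derivative along
nonnegative directions is nonnegative and log-concave on the nonnegative orthant. -/
def CompletelyLogConcave {m : ℕ} (f : MvPolynomial (Fin m) ℝ) : Prop :=
  ∀ (k : ℕ) (v : Fin k → Fin m → ℝ), (∀ j i, 0 ≤ v j i) →
    LogConcaveOn ((List.ofFn v).foldr dirDeriv f)

/-- The substituted polynomial is evaluated by applying the affine map to the point. -/
theorem eval_aeval_affine {n m : ℕ} (A : Matrix (Fin n) (Fin m) ℝ) (b : Fin n → ℝ)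
    (f : MvPolynomial (Fin n) ℝ) (x : Fin m → ℝ) :
    eval x (aeval (fun i : Fin n => (∑ j, C (A i j) * X j) + C (b i)) f) =
      eval (A *ᵥ x + b) f := by
  induction f using MvPolynomial.induction_on with
  | C a => simp
  | add p q hp hq => simp only [map_add, hp, hq]
  | mul_X p i hp =>
    simp only [map_mul, hp, aeval_X, eval_X]
    simp [Matrix.mulVec, dotProduct]

theorem dirDeriv_C {m : ℕ} (v : Fin m → ℝ) (a : ℝ) : dirDeriv v (C a) = 0 := by
  simp [dirDeriv]

theorem dirDeriv_add {m : ℕ} (v : Fin m → ℝ) (p q : MvPolynomial (Fin m) ℝ) :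
    dirDeriv v (p + q) = dirDeriv v p + dirDeriv v q := by
  simp [dirDeriv, mul_add, Finset.sum_add_distrib]

theorem dirDeriv_mul {m : ℕ} (v : Fin m → ℝ) (p q : MvPolynomial (Fin m) ℝ) :
    dirDeriv v (p * q) = dirDeriv v p * q + p * dirDeriv v q := by
  simp only [dirDeriv, Finset.sum_mul, Finset.mul_sum, ← Finset.sum_add_distrib]
  refine Finset.sum_congr rfl fun i _ => ?_
  rw [pderiv_mul]
  ring

theorem dirDeriv_X {m : ℕ} (v : Fin m → ℝ) (i : Fin m) : dirDeriv v (X i) = C (v i) := by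
  simp [dirDeriv, pderiv_X, Pi.single_apply]

theorem dirDeriv_affine {m : ℕ} (v a : Fin m → ℝ) (c : ℝ) :
    dirDeriv v ((∑ j, C (a j) * X j) + C c) = C (a ⬝ᵥ v) := by
  simp [dirDeriv, dotProduct, pderiv_X, Pi.single_apply, mul_comm]

/-- The chain rule for directional derivatives under an affine substitution. -/
theorem dirDeriv_aeval_affine {n m : ℕ} (A : Matrix (Fin n) (Fin m) ℝ) (b : Fin n → ℝ)
    (v : Fin m → ℝ) (f : MvPolynomial (Fin n) ℝ) :
    dirDeriv v (aeval (fun i : Fin n => (∑ j, C (A i j) * X j) + C (b i)) f) =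
      aeval (fun i : Fin n => (∑ j, C (A i j) * X j) + C (b i)) (dirDeriv (A *ᵥ v) f) := by
  induction f using MvPolynomial.induction_on with
  | C a => simp [dirDeriv_C, algebraMap_eq]
  | add p q hp hq => simp only [map_add, dirDeriv_add, hp, hq]
  | mul_X p i hp =>
    simp only [map_mul, dirDeriv_mul, hp, aeval_X, dirDeriv_X, dirDeriv_affine, map_add,
      aeval_C, algebraMap_eq, Matrix.mulVec]

theorem foldr_dirDeriv_aeval_affine {n m : ℕ} (A : Matrix (Fin n) (Fin m) ℝ) (b : Fin n → ℝ)
    (l : List (Fin m → ℝ)) (f : MvPolynomial (Fin n) ℝ) :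
    l.foldr dirDeriv (aeval (fun i : Fin n => (∑ j, C (A i j) * X j) + C (b i)) f) =
      aeval (fun i : Fin n => (∑ j, C (A i j) * X j) + C (b i))
        ((l.map (A *ᵥ ·)).foldr dirDeriv f) := by
  induction l with
  | nil => rfl
  | cons v l ih => rw [List.foldr_cons, ih, dirDeriv_aeval_affine, List.map_cons, List.foldr_cons]

/-- The linear part of an affine map preserving the nonnegative orthant is entrywise
nonnegative. -/
theorem entry_nonneg_of_affine_nonneg {n m : ℕ} (A : Matrix (Fin n) (Fin m) ℝ) (b : Fin n → ℝ)
    (hT : ∀ x : Fin m → ℝ, (∀ j, 0 ≤ x j) → ∀ i, 0 ≤ (A *ᵥ x + b) i)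
    (i : Fin n) (j : Fin m) : 0 ≤ A i j := by
  by_contra! h
  have hline (t : ℝ) (ht : 0 ≤ t) : 0 ≤ A i j * t + b i := by
    have hx : 0 ≤ (Pi.single j t : Fin m → ℝ) := Pi.single_nonneg.2 ht
    simpa [Matrix.mulVec_single, mul_comm] using hT (Pi.single j t) (fun l => hx l) i
  have hb : 0 ≤ b i := by simpa using hline 0 le_rfl
  have := hline ((b i + 1) / -A i j) (div_nonneg (by linarith) (by linarith))
  have heq : A i j * ((b i + 1) / -A i j) = -(b i + 1) := by
    field_simp [h.ne]
  linarith

/-- Log-concavity on the nonnegative orthant is preserved by affine substitutions preserving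
the orthant. -/
theorem LogConcaveOn.aeval_affine {n m : ℕ} {f : MvPolynomial (Fin n) ℝ} (hf : LogConcaveOn f)
    (A : Matrix (Fin n) (Fin m) ℝ) (b : Fin n → ℝ)
    (hT : ∀ x : Fin m → ℝ, (∀ j, 0 ≤ x j) → ∀ i, 0 ≤ (A *ᵥ x + b) i) :
    LogConcaveOn (aeval (fun i : Fin n => (∑ j, C (A i j) * X j) + C (b i)) f) := by
  refine ⟨fun x hx => ?_, fun u v hu hv t ht ht' => ?_⟩
  · rw [eval_aeval_affine]
    exact hf.1 _ (hT x hx)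
  · simp only [eval_aeval_affine]
    have hcomb : A *ᵥ (fun i => t * u i + (1 - t) * v i) + b =
        fun i => t * (A *ᵥ u + b) i + (1 - t) * (A *ᵥ v + b) i := by
      have : (fun i => t * u i + (1 - t) * v i) = t • u + (1 - t) • v := rfl
      rw [this, Matrix.mulVec_add, Matrix.mulVec_smul, Matrix.mulVec_smul]
      ext i
      simp only [Pi.add_apply, Pi.smul_apply, smul_eq_mul]
      ring
    rw [hcomb]
    exact hf.2 _ _ (hT u hu) (hT v hv) t ht ht'

/-- Complete log-concavity is preserved under composition with an affine map
`T(x) = Ax + b` sending the nonnegative orthant into the nonnegative orthant. -/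
theorem completelyLogConcave_affine_comp {n m : ℕ} (f : MvPolynomial (Fin n) ℝ)
    (hf : CompletelyLogConcave f)
    (A : Matrix (Fin n) (Fin m) ℝ) (b : Fin n → ℝ)
    (hT : ∀ x : Fin m → ℝ, (∀ j, 0 ≤ x j) → ∀ i, 0 ≤ (A *ᵥ x + b) i) :
    CompletelyLogConcave
      (MvPolynomial.aeval
        (fun i : Fin n =>
          (∑ j, MvPolynomial.C (A i j) * MvPolynomial.X j) + MvPolynomial.C (b i)) f) := by
  intro k v hv
  rw [foldr_dirDeriv_aeval_affine, List.map_ofFn]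
  have hAv (j : Fin k) (i : Fin n) : 0 ≤ (A *ᵥ v j) i := by
    simp only [Matrix.mulVec, dotProduct]
    exact Finset.sum_nonneg fun l _ =>
      mul_nonneg (entry_nonneg_of_affine_nonneg A b hT i l) (hv j l)
  exact LogConcaveOn.aeval_affine (hf k (fun j => A *ᵥ v j) hAv) A b hT
end

section
/- Let f ∈ ℝ[z_1,…,z_n] be homogeneous of degree d ≥ 3 with nonnegative coefficients and let a ∈ ℝ_{≥0}^n with f(a) ≠ 0. Then f is log-concave at a if and only if the polynomial D_a f = Σ_i a_i ∂_i f is log-concave at a. -/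
open Matrix MvPolynomial

/-- The Hessian matrix `∇²f(a)` of `f` at the point `a`. -/
noncomputable def hessAt {m : ℕ} (f : MvPolynomial (Fin m) ℝ) (a : Fin m → ℝ) :
    Matrix (Fin m) (Fin m) ℝ :=
  fun i j => MvPolynomial.eval a (MvPolynomial.pderiv i (MvPolynomial.pderiv j f))

/-- The Hessian of `log f` at `a`, namely `(f(a)·∇²f(a) − ∇f(a)·∇f(a)ᵀ) / f(a)²`. -/
noncomputable def logHessAt {m : ℕ} (f : MvPolynomial (Fin m) ℝ) (a : Fin m → ℝ) :
    Matrix (Fin m) (Fin m) ℝ :=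
  fun i j =>
    (MvPolynomial.eval a f * hessAt f a i j -
        MvPolynomial.eval a (MvPolynomial.pderiv i f) *
          MvPolynomial.eval a (MvPolynomial.pderiv j f)) /
      (MvPolynomial.eval a f) ^ 2

/-- A matrix `N` is negative semidefinite if `xᵀNx ≤ 0` for all `x`. -/
def IsNegSemidef {m : ℕ} (N : Matrix (Fin m) (Fin m) ℝ) : Prop :=
  ∀ x : Fin m → ℝ, x ⬝ᵥ (N *ᵥ x) ≤ 0

/-- `f` is log-concave at the point `a`: the Hessian of `log f` at `a` is
negative semidefinite. -/
def LogConcaveAt {m : ℕ} (f : MvPolynomial (Fin m) ℝ) (a : Fin m → ℝ) : Prop :=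
  IsNegSemidef (logHessAt f a)

theorem MvPolynomial.pderiv_pderiv_comm {σ R : Type*} [CommRing R] (i j : σ)
    (f : MvPolynomial σ R) : pderiv i (pderiv j f) = pderiv j (pderiv i f) := by
  classical
  have h : ⁅pderiv (R := R) i, pderiv (R := R) j⁆ = 0 := by
    apply MvPolynomial.derivation_ext
    intro k
    rw [Derivation.commutator_apply]
    simp [pderiv_X, Pi.single_apply, apply_ite]
  have h' := DFunLike.congr_fun h f
  rwa [Derivation.commutator_apply, Derivation.zero_apply, sub_eq_zero] at h'

/-- Euler's identity, evaluated at a point. -/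
theorem MvPolynomial.IsHomogeneous.sum_mul_eval_pderiv {σ R : Type*} [Fintype σ] [CommRing R]
    {k : ℕ} {f : MvPolynomial σ R} (hf : f.IsHomogeneous k) (a : σ → R) :
    ∑ i, a i * eval a (pderiv i f) = k * eval a f := by
  simpa using congrArg (eval a) hf.sum_X_mul_pderiv

theorem eval_dirDeriv {m : ℕ} (v a : Fin m → ℝ) (f : MvPolynomial (Fin m) ℝ) :
    eval a (dirDeriv v f) = ∑ i, v i * eval a (pderiv i f) := by
  simp [dirDeriv]

theorem pderiv_dirDeriv {m : ℕ} (v : Fin m → ℝ) (f : MvPolynomial (Fin m) ℝ) (i : Fin m) :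
    pderiv i (dirDeriv v f) = dirDeriv v (pderiv i f) := by
  simp [dirDeriv, MvPolynomial.pderiv_pderiv_comm i]

theorem MvPolynomial.IsHomogeneous.eval_dirDeriv_self {m k : ℕ} {f : MvPolynomial (Fin m) ℝ}
    (hf : f.IsHomogeneous k) (a : Fin m → ℝ) : eval a (dirDeriv a f) = k * eval a f := by
  rw [eval_dirDeriv, hf.sum_mul_eval_pderiv]

theorem hessAt_transpose {m : ℕ} (f : MvPolynomial (Fin m) ℝ) (a : Fin m → ℝ) :
    (hessAt f a)ᵀ = hessAt f a := by
  ext i j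
  exact congrArg (eval a) (MvPolynomial.pderiv_pderiv_comm j i f)

/-- Log-concavity at `a`, with the positive denominator `f(a)²` cleared. -/
theorem logConcaveAt_iff {m : ℕ} {f : MvPolynomial (Fin m) ℝ} {a : Fin m → ℝ}
    (hfa : eval a f ≠ 0) :
    LogConcaveAt f a ↔ ∀ x : Fin m → ℝ,
      eval a f * (x ⬝ᵥ hessAt f a *ᵥ x) ≤ (x ⬝ᵥ fun i => eval a (pderiv i f)) ^ 2 := by
  set p : Fin m → ℝ := fun i => eval a (pderiv i f) with hp
  have hM : logHessAt f a =
      (eval a f ^ 2)⁻¹ • (eval a f • hessAt f a - vecMulVec p p) := by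
    ext i j
    simp [logHessAt, vecMulVec_apply, hp, div_eq_inv_mul]
  refine forall_congr' fun x => ?_
  have hx : x ⬝ᵥ logHessAt f a *ᵥ x =
      (eval a f * (x ⬝ᵥ hessAt f a *ᵥ x) - (x ⬝ᵥ p) ^ 2) / eval a f ^ 2 := by
    rw [hM, smul_mulVec, sub_mulVec, smul_mulVec, vecMulVec_mulVec, dotProduct_smul,
      dotProduct_sub, dotProduct_smul, op_smul_eq_smul, dotProduct_smul, dotProduct_comm p x]
    simp only [smul_eq_mul]
    ring
  rw [hx, div_le_iff₀ (by positivity), zero_mul, sub_nonpos]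

/-- If `H` and `p` satisfy the Euler identities of a Hessian and a gradient at `a`, then the bound
`α F xᵀHx ≤ (xᵀp)²` holds for all `x` as soon as `F yᵀHy ≤ 0` on the hyperplane orthogonal to `p`,
and conversely; this criterion does not depend on `α`. -/
theorem forall_mul_quadForm_le_sq_iff {m : ℕ} {H : Matrix (Fin m) (Fin m) ℝ} (hH : Hᵀ = H)
    {a p : Fin m → ℝ} {F d α : ℝ} (hF : F ≠ 0) (hd : 0 < d) (hα : 0 < α)
    (hαd : α * (d - 1) ≤ d) (hHa : H *ᵥ a = (d - 1) • p) (hpa : a ⬝ᵥ p = d * F) :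
    (∀ x, α * (F * (x ⬝ᵥ H *ᵥ x)) ≤ (x ⬝ᵥ p) ^ 2) ↔
      ∀ y, y ⬝ᵥ p = 0 → F * (y ⬝ᵥ H *ᵥ y) ≤ 0 := by
  constructor
  · intro h y hy
    have := h y
    rw [hy, zero_pow two_ne_zero] at this
    exact nonpos_of_mul_nonpos_right this hα
  · intro h x
    have haHx : a ⬝ᵥ H *ᵥ x = (d - 1) * (x ⬝ᵥ p) := by
      rw [dotProduct_mulVec, ← mulVec_transpose, hH, hHa, smul_dotProduct, dotProduct_comm p,
        smul_eq_mul]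
    have hy := h ((F * d) • x - (x ⬝ᵥ p) • a) (by
      simp only [sub_dotProduct, smul_dotProduct, hpa, smul_eq_mul]
      ring)
    simp only [mulVec_sub, mulVec_smul, dotProduct_sub, sub_dotProduct, smul_dotProduct,
      dotProduct_smul, haHx, hHa, hpa, smul_eq_mul] at hy
    have hFd : 0 < F ^ 2 * d := by positivity
    have key : d * (F * (x ⬝ᵥ H *ᵥ x)) ≤ (d - 1) * (x ⬝ᵥ p) ^ 2 := by
      refine le_of_mul_le_mul_left ?_ hFd
      linarith
    refine le_of_mul_le_mul_left ?_ hd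
    calc d * (α * (F * (x ⬝ᵥ H *ᵥ x))) = α * (d * (F * (x ⬝ᵥ H *ᵥ x))) := by ring
      _ ≤ α * ((d - 1) * (x ⬝ᵥ p) ^ 2) := by gcongr
      _ = α * (d - 1) * (x ⬝ᵥ p) ^ 2 := by ring
      _ ≤ d * (x ⬝ᵥ p) ^ 2 := by gcongr

/-- Let `f` be homogeneous of degree `d ≥ 3` with nonnegative coefficients and
`a ∈ ℝ_{≥0}^n` with `f(a) ≠ 0`. Then `f` is log-concave at `a` iff `D_a f` is
log-concave at `a`. -/
theorem logConcaveAt_iff_dirDeriv {n d : ℕ} (hd : 3 ≤ d)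
    (f : MvPolynomial (Fin n) ℝ)
    (hhom : f.IsHomogeneous d) (hcoeff : ∀ m, 0 ≤ f.coeff m)
    (a : Fin n → ℝ) (ha : ∀ i, 0 ≤ a i) (hfa : MvPolynomial.eval a f ≠ 0) :
    LogConcaveAt f a ↔ LogConcaveAt (dirDeriv a f) a := by
  have h1 (i : Fin n) : (pderiv i f).IsHomogeneous (d - 1) := hhom.pderiv
  have h2 (i j : Fin n) : (pderiv i (pderiv j f)).IsHomogeneous (d - 2) := (h1 j).pderiv
  have hd' : (3 : ℝ) ≤ d := by exact_mod_cast hd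
  have hc1 : ((d - 1 : ℕ) : ℝ) = d - 1 := by rw [Nat.cast_sub (by lia), Nat.cast_one]
  have hc2 : ((d - 2 : ℕ) : ℝ) = d - 2 := by rw [Nat.cast_sub (by lia), Nat.cast_two]
  set F := eval a f with hF
  set p : Fin n → ℝ := fun i => eval a (pderiv i f) with hp
  have hg : eval a (dirDeriv a f) = d * F := hhom.eval_dirDeriv_self a
  have hgp : (fun i => eval a (pderiv i (dirDeriv a f))) = ((d : ℝ) - 1) • p := by
    ext i
    simp [pderiv_dirDeriv, (h1 i).eval_dirDeriv_self, hc1, hp]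
  have hgH : hessAt (dirDeriv a f) a = ((d : ℝ) - 2) • hessAt f a := by
    ext i j
    simp [hessAt, pderiv_dirDeriv, (h2 i j).eval_dirDeriv_self, hc2]
  have hpa : a ⬝ᵥ p = d * F := hhom.sum_mul_eval_pderiv a
  have hHa : hessAt f a *ᵥ a = ((d : ℝ) - 1) • p := by
    rw [← hessAt_transpose]
    ext i
    have := (h1 i).sum_mul_eval_pderiv a
    simpa [mulVec, dotProduct, hessAt, hc1, hp, mul_comm] using this
  have hquad {α : ℝ} (hα : 0 < α) (hαd : α * (d - 1) ≤ d) :=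
    forall_mul_quadForm_le_sq_iff (hessAt_transpose f a) hfa (by linarith) hα hαd hHa hpa
  have hd1 : (0 : ℝ) < d - 1 := by linarith
  have hd2 : (0 : ℝ) < d - 2 := by linarith
  have hα : (0 : ℝ) < d * (d - 2) / (d - 1) ^ 2 := by positivity
  have hαd : (d : ℝ) * (d - 2) / (d - 1) ^ 2 * (d - 1) ≤ d := by
    rw [div_mul_eq_mul_div, div_le_iff₀ (by positivity)]
    nlinarith [mul_pos (show (0 : ℝ) < d by linarith) hd1]
  rw [logConcaveAt_iff hfa, logConcaveAt_iff (by rw [hg]; positivity), hg, hgp, hgH]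
  have hone := hquad one_pos (by linarith)
  simp only [one_mul] at hone
  rw [hone, ← hquad hα hαd]
  refine forall_congr' fun x => ?_
  rw [smul_mulVec, dotProduct_smul, dotProduct_smul, smul_eq_mul, smul_eq_mul, mul_pow,
    div_mul_eq_mul_div, div_le_iff₀ (by positivity)]
  ring_nf
end
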